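/- Define γ₃ : ℕ₊ → ℤ by: γ₃(n) = (if n is a perfect square then χ_{−3}(√n)·√n else 0) + 4·Σ over pairs of positive integers (m₁,m₂) with 4m₁²+9m₂² = n of χ_{−3}(m₁)·m₁ + 2·Σ over pairs of positive integers (m₁,m₂) with m₁²+36m₂² = n of χ_{−3}(m₁)·m₁, if n ≡ 1 (mod 12); γ₃(n) = 2·Σ over pairs of positive integers (m₁,m₂) with 4m₁²+m₂² = n of χ_{−3}(m₁)·m₁ + Σ over pairs of positive integers (m₁,m₂) with m₁²+4m₂² = n of χ_{−3}(m₁)·m₁, if n ≡ 5 (mod 12); and γ₃(n) = 0 otherwise. Then for every positive integer n, γ₃(n) = 0 if and only if gcd(n,6) > 1 or there exists a prime p ≡ 3 (mod 4) such that ord_p(n) is odd. -/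

import Mathlib

open Finset

/-- The quadratic character modulo 3. -/
def χ₃ (m : ℕ) : ℤ := if m % 3 = 1 then 1 else if m % 3 = 2 then -1 else 0

/-- The arithmetic function `γ₃` attached to the newform `g₃ ∈ S₂(Γ₀(144), χ₁₂)`. -/
noncomputable def gamma3 (n : ℕ) : ℤ :=
  if n % 12 = 1 then
    (if Nat.sqrt n * Nat.sqrt n = n then χ₃ (Nat.sqrt n) * (Nat.sqrt n : ℤ) else 0)
      + 4 * ∑ p ∈ (Finset.Icc 1 n ×ˢ Finset.Icc 1 n).filter (fun p => 4 * p.1 ^ 2 + 9 * p.2 ^ 2 = n), χ₃ p.1 * p.1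
      + 2 * ∑ p ∈ (Finset.Icc 1 n ×ˢ Finset.Icc 1 n).filter (fun p => p.1 ^ 2 + 36 * p.2 ^ 2 = n), χ₃ p.1 * p.1
  else if n % 12 = 5 then
    2 * ∑ p ∈ (Finset.Icc 1 n ×ˢ Finset.Icc 1 n).filter (fun p => 4 * p.1 ^ 2 + p.2 ^ 2 = n), χ₃ p.1 * p.1
      + ∑ p ∈ (Finset.Icc 1 n ×ˢ Finset.Icc 1 n).filter (fun p => p.1 ^ 2 + 4 * p.2 ^ 2 = n), χ₃ p.1 * p.1
  else 0


/-! ### The Hecke character -/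

open Complex in
/-- A primitive eighth root of unity with `zt ^ 2 = -I`. -/
noncomputable def zt : ℂ := (1 - I) * ((Real.sqrt 2 : ℝ) : ℂ)⁻¹

lemma zt_sq : zt ^ 2 = -Complex.I := by
  have h : (((Real.sqrt 2 : ℝ) : ℂ)) ^ 2 = 2 := by
    norm_cast
    simp
  unfold zt
  rw [mul_pow, inv_pow, h]
  have := Complex.I_sq
  linear_combination (1/2) * this

lemma zt_pow8 : zt ^ 8 = 1 := by
  have h : zt ^ 8 = (zt ^ 2) ^ 4 := by ring
  rw [h, zt_sq]
  simp [Even.neg_pow (by decide : Even 4)]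

lemma zt_ne : zt ≠ 0 := by
  intro h
  have := zt_pow8
  rw [h] at this
  norm_num at this

/-- Discrete logarithm in base `1 + i` on the nonzero elements of `ℤ[i]/3`. -/
def t3 (a b : ZMod 3) : ℕ :=
  if a = 1 then (if b = 0 then 0 else if b = 1 then 1 else 3)
  else if a = 2 then (if b = 0 then 4 else if b = 2 then 5 else 7)
  else (if b = 2 then 2 else 6)

/-- The 3-part of the character. -/
noncomputable def G3 (a b : ZMod 3) : ℂ := if a = 0 ∧ b = 0 then 0 else zt ^ t3 a b

/-- The 2-part of the character. -/
def G2 (a b : ZMod 2) : ℤ := if a = b then 0 else if b = 0 then 1 else -1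

lemma G2_mul : ∀ a b c d : ZMod 2, G2 (a * c - b * d) (a * d + b * c) = G2 a b * G2 c d := by
  decide

lemma t3_mul : ∀ a b c d : ZMod 3, ¬ (a = 0 ∧ b = 0) → ¬ (c = 0 ∧ d = 0) →
    ¬ (a * c - b * d = 0 ∧ a * d + b * c = 0) ∧
      t3 (a * c - b * d) (a * d + b * c) % 8 = (t3 a b + t3 c d) % 8 := by
  decide

lemma G3_mul (a b c d : ZMod 3) : G3 (a * c - b * d) (a * d + b * c) = G3 a b * G3 c d := by
  by_cases h1 : a = 0 ∧ b = 0
  · simp [G3, h1]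
  by_cases h2 : c = 0 ∧ d = 0
  · simp [G3, h2]
  obtain ⟨h3, h4⟩ := t3_mul a b c d h1 h2
  unfold G3
  rw [if_neg h1, if_neg h2, if_neg h3, ← pow_add, pow_eq_pow_mod _ zt_pow8, h4,
    ← pow_eq_pow_mod _ zt_pow8]

/-- The finite-order part of the Hecke character. -/
noncomputable def eps (α : GaussianInt) : ℂ :=
  G3 (α.re : ZMod 3) (α.im : ZMod 3) * (G2 (α.re : ZMod 2) (α.im : ZMod 2) : ℂ)

lemma eps_mul (α β : GaussianInt) : eps (α * β) = eps α * eps β := by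
  have h2 := G2_mul (α.re) α.im β.re β.im
  have h3 := G3_mul (α.re) α.im β.re β.im
  unfold eps
  have e1 : (((α * β).re : ℤ)) = α.re * β.re - α.im * β.im := by simp; ring
  have e2 : (((α * β).im : ℤ)) = α.re * β.im + α.im * β.re := by simp
  rw [e1, e2]
  push_cast
  rw [h2, h3]
  push_cast
  ring

lemma eps_one : eps 1 = 1 := by
  simp [eps, G2, G3, t3]

/-- The Hecke character on elements, as a monoid homomorphism. -/
noncomputable def psi : GaussianInt →* ℂ where
  toFun α := eps α * GaussianInt.toComplex α
  map_one' := by simp [eps_one]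
  map_mul' α β := by simp [eps_mul]; ring

lemma psi_apply (α : GaussianInt) : psi α = eps α * GaussianInt.toComplex α := rfl

lemma G3_pow8 (a b : ZMod 3) (h : ¬ (a = 0 ∧ b = 0)) : G3 a b ^ 8 = 1 := by
  unfold G3
  rw [if_neg h, ← pow_mul, mul_comm, pow_mul, zt_pow8, one_pow]

lemma G2_pow8 : ∀ a b : ZMod 2, a ≠ b → G2 a b ^ 8 = 1 := by decide

lemma eps_pow8 (α : GaussianInt) (h : IsCoprime α.norm 6) : eps α ^ 8 = 1 := by
  have h3 : IsCoprime α.norm 3 := h.of_isCoprime_of_dvd_right (by norm_num)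
  have h2 : IsCoprime α.norm 2 := h.of_isCoprime_of_dvd_right (by norm_num)
  have hn : α.norm = α.re * α.re + α.im * α.im := by simp [Zsqrtd.norm]
  unfold eps
  rw [mul_pow, G3_pow8]
  · have : (G2 (α.re : ZMod 2) (α.im : ZMod 2)) ^ 8 = 1 := by
      apply G2_pow8
      intro h
      have h4 : ((α.norm : ℤ) : ZMod 2) = 0 := by
        rw [hn]; push_cast; rw [h, ← two_mul, show (2 : ZMod 2) = 0 from rfl, zero_mul]
      have h5 := (ZMod.intCast_zmod_eq_zero_iff_dvd _ 2).1 h4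
      have := h2.isUnit_of_dvd' (x := 2) (by exact_mod_cast h5) dvd_rfl
      rw [Int.isUnit_iff] at this; omega
    rw [one_mul]
    exact_mod_cast this
  · rintro ⟨ha, hb⟩
    have h4 : ((α.norm : ℤ) : ZMod 3) = 0 := by
      rw [hn]; push_cast; rw [ha, hb]; simp
    have h5 := (ZMod.intCast_zmod_eq_zero_iff_dvd _ 3).1 h4
    have := h3.isUnit_of_dvd' (x := 3) (by exact_mod_cast h5) dvd_rfl
    rw [Int.isUnit_iff] at this; omega

/-! ### The theta sum and its factorisation -/

/-- Pairs of integers with `a ^ 2 + b ^ 2 = n`. -/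
noncomputable def Rp (n : ℕ) : Finset (ℤ × ℤ) :=
  (Finset.Icc (-(n : ℤ)) n ×ˢ Finset.Icc (-(n : ℤ)) n).filter (fun p => p.1 ^ 2 + p.2 ^ 2 = n)

/-- Pairs of integers as Gaussian integers. -/
def gE : ℤ × ℤ ↪ GaussianInt where
  toFun p := ⟨p.1, p.2⟩
  inj' p q h := by simpa [Zsqrtd.ext_iff, Prod.ext_iff] using h

lemma gE_apply (a b : ℤ) : gE (a, b) = ⟨a, b⟩ := rfl

/-- Gaussian integers of norm `n`. -/
noncomputable def Rg (n : ℕ) : Finset GaussianInt := (Rp n).map gE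

lemma mem_Rg (n : ℕ) (α : GaussianInt) : α ∈ Rg n ↔ α.norm = n := by
  have hn : α.norm = α.re ^ 2 + α.im ^ 2 := by simp [Zsqrtd.norm]; ring
  rw [hn]
  unfold Rg Rp
  simp only [Finset.mem_map, Finset.mem_filter, Finset.mem_product, Finset.mem_Icc,
    gE_apply, Prod.exists]
  constructor
  · rintro ⟨a, b, ⟨h1, h2⟩, rfl⟩
    exact h2
  · intro h
    refine ⟨α.re, α.im, ⟨⟨⟨?_, ?_⟩, ?_, ?_⟩, h⟩, rfl⟩
    all_goals
      nlinarith [sq_nonneg α.re, sq_nonneg α.im, Int.le_self_sq α.re, Int.le_self_sq (-α.re),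
        Int.le_self_sq α.im, Int.le_self_sq (-α.im)]

/-- The theta sum. -/
noncomputable def W (n : ℕ) : ℂ := ∑ α ∈ Rg n, psi α

lemma W_one : W 1 = 4 := by
  have : Rg 1 = {1, -1, ⟨0, 1⟩, ⟨0, -1⟩} := by decide
  unfold W
  rw [this]
  have z2 := zt_sq
  have z4 : zt ^ 4 = -1 := by
    rw [show zt ^ 4 = (zt ^ 2) ^ 2 by ring, z2]; simp
  have z6 : zt ^ 6 = Complex.I := by
    rw [show zt ^ 6 = zt ^ 4 * zt ^ 2 by ring, z2, z4]; simp
  rw [Finset.sum_insert (by decide), Finset.sum_insert (by decide), Finset.sum_insert (by decide),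
    Finset.sum_singleton]
  have a1 : psi 1 = 1 := map_one _
  have a2 : psi (-1) = 1 := by
    have : t3 (-1) 0 = 4 := by decide
    have h2 : G2 1 0 = 1 := by decide
    simp [psi_apply, eps, G3, this, z4, h2]
  have a3 : psi ⟨0, 1⟩ = 1 := by
    have : t3 0 1 = 6 := by decide
    have h2 : G2 0 1 = -1 := by decide
    simp [psi_apply, eps, G3, this, z6, h2, GaussianInt.toComplex_def]
  have a4 : psi ⟨0, -1⟩ = 1 := by
    have : t3 0 (-1) = 2 := by decide
    have h2 : G2 0 1 = -1 := by decide
    simp [psi_apply, eps, G3, this, z2, h2, GaussianInt.toComplex_def]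
  rw [a1, a2, a3, a4]
  norm_num

lemma prime_of_norm (p : ℕ) (hp : p.Prime) (π : GaussianInt) (h : π.norm = p) : Prime π := by
  rw [← irreducible_iff_prime]
  constructor
  · intro hu
    have := (Zsqrtd.norm_eq_one_iff (x := π)).2 hu
    rw [h] at this
    simp at this
    exact hp.one_lt.ne' this
  · intro a b hab
    have h2 : a.norm.natAbs * b.norm.natAbs = p := by
      rw [← Int.natAbs_mul, ← Zsqrtd.norm_mul, ← hab, h]; simp
    rcases Nat.Prime.eq_one_or_self_of_dvd hp _ (Dvd.intro _ h2) with h3 | h3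
    · left; exact Zsqrtd.norm_eq_one_iff.1 h3
    · right
      apply Zsqrtd.norm_eq_one_iff.1
      rw [h3] at h2
      exact Nat.eq_of_mul_eq_mul_left hp.pos (by simpa using h2)

lemma not_dvd_star (p : ℕ) (hp : p.Prime) (h2 : p ≠ 2) (π : GaussianInt) (h : π.norm = p) :
    ¬ π ∣ star π := by
  intro hd
  have h3 : π ∣ π + star π := (dvd_refl π).add hd
  have h4 : π + star π = ⟨2 * π.re, 0⟩ := by
    ext <;> simp; ring
  rw [h4] at h3
  obtain ⟨β, hβ⟩ := h3
  have h5 := congrArg Zsqrtd.norm hβ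
  rw [Zsqrtd.norm_mul, h] at h5
  have hn : π.norm = π.re ^ 2 + π.im ^ 2 := by simp [Zsqrtd.norm]; ring
  have h6 : (p : ℤ) ∣ (2 * π.re) * (2 * π.re) := by
    refine ⟨β.norm, ?_⟩
    rw [← h5]; simp [Zsqrtd.norm]
  have hp' : Prime (p : ℤ) := Nat.prime_iff_prime_int.1 hp
  have h7 : (p : ℤ) ∣ π.re := by
    have h8 : (p : ℤ) ∣ 2 * π.re := by
      rcases hp'.dvd_or_dvd h6 with h | h <;> exact h
    rcases hp'.dvd_or_dvd h8 with h | h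
    · exfalso
      have : p ∣ 2 := by exact_mod_cast h
      exact h2 ((Nat.prime_dvd_prime_iff_eq hp Nat.prime_two).1 this)
    · exact h
  have h8 : (p : ℤ) ∣ π.im := by
    have : (p : ℤ) ∣ π.im ^ 2 := by
      have e : π.im ^ 2 = p - π.re * π.re := by rw [← h, hn]; ring
      rw [e]
      exact dvd_sub dvd_rfl (h7.mul_right _)
    exact hp'.dvd_of_dvd_pow this
  obtain ⟨u, hu⟩ := h7
  obtain ⟨v, hv⟩ := h8
  have h9 : (p : ℤ) * 1 = p * (p * (u ^ 2 + v ^ 2)) := by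
    rw [h, hu, hv] at hn
    linarith
  have h10 := mul_left_cancel₀ hp'.ne_zero h9
  have h11 : IsUnit (p : ℤ) := IsUnit.of_mul_eq_one _ h10.symm
  exact hp'.not_isUnit h11

lemma dvd_norm_of_dvd (p : ℕ) (π β : GaussianInt) (h : π.norm = p) (m : ℕ) (hβ : β.norm = m)
    (hd : π ∣ β) : p ∣ m := by
  obtain ⟨γ, rfl⟩ := hd
  rw [Zsqrtd.norm_mul, h] at hβ
  have : (p : ℤ) ∣ m := ⟨_, hβ.symm⟩
  exact_mod_cast this

lemma norm_star' (π : GaussianInt) : (star π).norm = π.norm := Zsqrtd.norm_conj π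

lemma split_surj (p : ℕ) (hp : p.Prime) (π : GaussianInt) (h : π.norm = p) (m : ℕ) (k : ℕ) :
    ∀ α : GaussianInt, α.norm = (p ^ k * m : ℕ) →
      ∃ j ≤ k, ∃ β : GaussianInt, β.norm = m ∧ π ^ j * star π ^ (k - j) * β = α := by
  have hp0 : (p : ℤ) ≠ 0 := by exact_mod_cast hp.ne_zero
  induction k with
  | zero => intro α hα; exact ⟨0, le_rfl, α, by simpa using hα, by simp⟩
  | succ k ih =>
    intro α hα
    have hπ := prime_of_norm p hp π h
    have h1 : π ∣ α * star α := by
      rw [← Zsqrtd.norm_eq_mul_conj, hα]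
      have : (((p ^ (k + 1) * m : ℕ) : ℤ) : GaussianInt) = π * (star π * ((p ^ k * m : ℕ) : ℤ)) := by
        rw [← mul_assoc, ← Zsqrtd.norm_eq_mul_conj, h]
        push_cast; ring
      rw [this]
      exact dvd_mul_right _ _
    have key : ∀ σ α' : GaussianInt, σ.norm = p → α = σ * α' → α'.norm = (p ^ k * m : ℕ) := by
      intro σ α' hσ e
      rw [e, Zsqrtd.norm_mul, hσ] at hα
      apply mul_left_cancel₀ hp0
      rw [hα]; push_cast; ring
    rcases hπ.dvd_or_dvd h1 with h2 | h2
    · obtain ⟨α', e⟩ := h2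
      obtain ⟨j, hj, β, hβ, e'⟩ := ih α' (key π α' h e)
      refine ⟨j + 1, by omega, β, hβ, ?_⟩
      rw [e, ← e', show k + 1 - (j + 1) = k - j by omega]; ring
    · have h3 : star π ∣ α := by
        obtain ⟨γ, hγ⟩ := h2
        refine ⟨star γ, ?_⟩
        rw [← star_star α, hγ, star_mul, mul_comm]
      obtain ⟨α', e⟩ := h3
      obtain ⟨j, hj, β, hβ, e'⟩ := ih α' (key (star π) α' ((norm_star' π).trans h) e)
      refine ⟨j, by omega, β, hβ, ?_⟩
      rw [e, ← e', show k + 1 - j = (k - j) + 1 by omega]; ring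

lemma split_inj_aux (p : ℕ) (hp : p.Prime) (h2 : p ≠ 2) (π : GaussianInt) (h : π.norm = p)
    (m : ℕ) (hm : ¬ p ∣ m) (k j j' : ℕ) (hj : j < j') (hj' : j' ≤ k) (β β' : GaussianInt)
    (hβ : β.norm = m) (e : π ^ j * star π ^ (k - j) * β = π ^ j' * star π ^ (k - j') * β') :
    False := by
  have hπ := prime_of_norm p hp π h
  have e2 : π ^ j * (star π ^ (k - j) * β) = π ^ j * (π * (π ^ (j' - j - 1) * star π ^ (k - j') * β')) := by
    rw [← mul_assoc, e]
    conv_lhs => rw [show j' = j + (1 + (j' - j - 1)) by omega]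
    rw [pow_add, pow_add, show k - (j + (1 + (j' - j - 1))) = k - j' by omega]
    ring
  have e3 := mul_left_cancel₀ (pow_ne_zero _ hπ.ne_zero) e2
  have h3 : π ∣ star π ^ (k - j) * β := ⟨_, e3⟩
  rcases hπ.dvd_or_dvd h3 with h4 | h4
  · exact not_dvd_star p hp h2 π h (hπ.dvd_of_dvd_pow h4)
  · exact hm (dvd_norm_of_dvd p π β h m hβ h4)

lemma W_split (p : ℕ) (hp : p.Prime) (h2 : p ≠ 2) (π : GaussianInt) (h : π.norm = p)
    (m : ℕ) (hm : ¬ p ∣ m) (k : ℕ) :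
    W (p ^ k * m) = (∑ j ∈ Finset.range (k + 1), psi π ^ j * psi (star π) ^ (k - j)) * W m := by
  unfold W
  rw [Finset.sum_mul_sum, ← Finset.sum_product']
  symm
  have hπ := prime_of_norm p hp π h
  have hπ' := prime_of_norm p hp (star π) ((norm_star' π).trans h)
  refine Finset.sum_bij (fun x _ => π ^ x.1 * star π ^ (k - x.1) * x.2) ?_ ?_ ?_ ?_
  · rintro ⟨j, β⟩ hx
    simp only [Finset.mem_product, Finset.mem_range, mem_Rg] at hx
    rw [mem_Rg, Zsqrtd.norm_mul, hx.2]
    have e1 : ∀ (σ : GaussianInt) (r : ℕ), (σ ^ r).norm = σ.norm ^ r :=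
      fun σ r => map_pow (Zsqrtd.normMonoidHom) σ r
    rw [Zsqrtd.norm_mul, e1, e1, norm_star', h, ← pow_add]
    rw [show j + (k - j) = k by omega]
    push_cast; ring
  · rintro ⟨j, β⟩ hx ⟨j', β'⟩ hx' e
    simp only [Finset.mem_product, Finset.mem_range, mem_Rg] at hx hx' e
    rcases lt_trichotomy j j' with hl | hl | hl
    · exact (split_inj_aux p hp h2 π h m hm k j j' hl (by omega) β β' hx.2 e).elim
    · subst hl
      rw [mul_left_cancel₀ (mul_ne_zero (pow_ne_zero _ hπ.ne_zero) (pow_ne_zero _ hπ'.ne_zero)) e]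
    · exact (split_inj_aux p hp h2 π h m hm k j' j hl (by omega) β' β hx'.2 e.symm).elim
  · intro α hα
    rw [mem_Rg] at hα
    obtain ⟨j, hj, β, hβ, e⟩ := split_surj p hp π h m k α hα
    exact ⟨(j, β), by simp [mem_Rg, hβ]; omega, e⟩
  · rintro ⟨j, β⟩ hx
    simp

lemma coprime_norm (p : ℕ) (hp : p.Prime) (h2 : p ≠ 2) (h3 : p ≠ 3) (π : GaussianInt)
    (h : π.norm = p) : IsCoprime π.norm 6 := by
  rw [h]
  have : Nat.Coprime p 6 := by
    rw [show 6 = 2 * 3 from rfl]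
    exact Nat.Coprime.mul_right ((Nat.coprime_primes hp Nat.prime_two).2 h2)
      ((Nat.coprime_primes hp Nat.prime_three).2 h3)
  exact_mod_cast Nat.isCoprime_iff_coprime.2 this

lemma geom_ne (p : ℕ) (hp : p.Prime) (h2 : p ≠ 2) (h3 : p ≠ 3) (π : GaussianInt)
    (h : π.norm = p) (k : ℕ) :
    (∑ j ∈ Finset.range (k + 1), psi π ^ j * psi (star π) ^ (k - j)) ≠ 0 := by
  intro h0
  have hπ := prime_of_norm p hp π h
  have e := (Commute.all (psi π) (psi (star π))).geom_sum₂_mul (k + 1)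
  simp only [Nat.add_sub_cancel] at e
  rw [h0, zero_mul] at e
  have e2 : psi π ^ (k + 1) = psi (star π) ^ (k + 1) := (sub_eq_zero.1 e.symm)
  have e3 : (psi π ^ 8) ^ (k + 1) = (psi (star π) ^ 8) ^ (k + 1) := by
    rw [← pow_mul, ← pow_mul, mul_comm, pow_mul, pow_mul, e2]
  rw [psi_apply, psi_apply, mul_pow (eps π), mul_pow (eps (star π)),
    eps_pow8 _ (coprime_norm p hp h2 h3 π h),
    eps_pow8 _ (coprime_norm p hp h2 h3 _ ((norm_star' π).trans h)), one_mul, one_mul,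
    ← map_pow, ← map_pow, ← map_pow, ← map_pow] at e3
  have e4 : (π ^ 8) ^ (k + 1) = (star π ^ 8) ^ (k + 1) := GaussianInt.toComplex_injective e3
  have h5 : π ∣ (star π ^ 8) ^ (k + 1) := by
    rw [← e4]
    exact (dvd_pow_self _ (by norm_num)).trans (dvd_pow_self _ (by omega))
  exact not_dvd_star p hp h2 π h (hπ.dvd_of_dvd_pow (hπ.dvd_of_dvd_pow h5))

lemma W_inert (q : ℕ) (hq : q.Prime) (h4 : q % 4 = 3) (m : ℕ) (k : ℕ) :
    W (q ^ (2 * k) * m) = psi (q : GaussianInt) ^ k * W m := by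
  have := Fact.mk hq
  have hπ : Prime (q : GaussianInt) := GaussianInt.prime_of_nat_prime_of_mod_four_eq_three q h4
  have hq0 : (q : ℤ) ≠ 0 := by exact_mod_cast hq.ne_zero
  have hN : (q : GaussianInt).norm = q * q := Zsqrtd.norm_natCast q
  induction k with
  | zero => simp
  | succ k ih =>
    rw [pow_succ', mul_assoc, ← ih]
    unfold W
    rw [Finset.mul_sum]
    symm
    refine Finset.sum_bij (fun β _ => q * β) ?_ ?_ ?_ ?_
    · intro β hβ
      rw [mem_Rg] at hβ ⊢
      rw [Zsqrtd.norm_mul, hβ, hN]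
      push_cast; ring
    · intro β _ β' _ e
      exact mul_left_cancel₀ hπ.ne_zero e
    · intro α hα
      rw [mem_Rg] at hα
      have h1 : (q : GaussianInt) ∣ α * star α := by
        rw [← Zsqrtd.norm_eq_mul_conj, hα]
        refine ⟨((q ^ (2 * k + 1) * m : ℕ) : GaussianInt), ?_⟩
        push_cast; ring
      have h2 : (q : GaussianInt) ∣ α := by
        rcases hπ.dvd_or_dvd h1 with h2 | h2
        · exact h2
        · obtain ⟨γ, hγ⟩ := h2
          refine ⟨star γ, ?_⟩
          rw [← star_star α, hγ, star_mul, mul_comm, star_natCast]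
      obtain ⟨β, rfl⟩ := h2
      refine ⟨β, ?_, rfl⟩
      rw [mem_Rg]
      rw [Zsqrtd.norm_mul, hN] at hα
      apply mul_left_cancel₀ (mul_ne_zero hq0 hq0)
      rw [hα]; push_cast; ring
    · intro β _
      simp

lemma psi_inert_ne (q : ℕ) (hq : q.Prime) (h2 : q ≠ 2) (h3 : q ≠ 3) :
    psi (q : GaussianInt) ≠ 0 := by
  rw [psi_apply]
  apply mul_ne_zero
  · intro h0
    have : IsCoprime (q : GaussianInt).norm 6 := by
      have h := coprime_norm q hq h2 h3
      rw [Zsqrtd.norm_natCast]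
      have : Nat.Coprime q 6 := by
        rw [show 6 = 2 * 3 from rfl]
        exact Nat.Coprime.mul_right ((Nat.coprime_primes hq Nat.prime_two).2 h2)
          ((Nat.coprime_primes hq Nat.prime_three).2 h3)
      have h' : IsCoprime (q : ℤ) 6 := by exact_mod_cast Nat.isCoprime_iff_coprime.2 this
      exact h'.mul_left h'
    have := eps_pow8 _ this
    rw [h0] at this
    norm_num at this
  · simpa using hq.ne_zero

lemma W_ne (n : ℕ) : 0 < n → Nat.Coprime n 6 →
    (∀ p : ℕ, p.Prime → p % 4 = 3 → ¬ Odd (padicValNat p n)) → W n ≠ 0 := by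
  induction n using Nat.strong_induction_on with
  | _ n ih =>
    intro hn hc hodd
    by_cases h1 : n = 1
    · subst h1; rw [W_one]; norm_num
    obtain ⟨p, hp, hpn⟩ := Nat.exists_prime_and_dvd h1
    obtain ⟨k, m, hm, e⟩ := Nat.exists_eq_pow_mul_and_not_dvd hn.ne' p hp.ne_one
    have := Fact.mk hp
    have hm0 : m ≠ 0 := by rintro rfl; simp at hm
    have hk0 : k ≠ 0 := by
      rintro rfl
      rw [pow_zero, one_mul] at e
      exact hm (e ▸ hpn)
    have hp6 : Nat.Coprime p 6 := hc.coprime_dvd_left hpn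
    have h2 : p ≠ 2 := by rintro rfl; revert hp6; decide
    have h3 : p ≠ 3 := by rintro rfl; revert hp6; decide
    have hval : padicValNat p n = k := by
      rw [e, padicValNat.mul (pow_ne_zero _ hp.ne_zero) hm0, padicValNat.prime_pow,
        padicValNat.eq_zero_of_not_dvd hm, add_zero]
    have hmn : m < n := by
      rw [e]
      have : 1 < p ^ k := Nat.one_lt_pow hk0 hp.one_lt
      nlinarith [Nat.pos_of_ne_zero hm0]
    have hW : W m ≠ 0 := by
      apply ih m hmn (Nat.pos_of_ne_zero hm0) (hc.coprime_dvd_left ⟨_, e.trans (mul_comm _ _)⟩)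
      intro q hq hq4
      have := Fact.mk hq
      by_cases hqp : q = p
      · subst hqp
        rw [padicValNat.eq_zero_of_not_dvd hm]; decide
      · have h5 := hodd q hq hq4
        rwa [e, padicValNat.mul (pow_ne_zero _ hp.ne_zero) hm0,
          padicValNat.pow _ , padicValNat_primes hqp, mul_zero, zero_add] at h5
    have hp4 : p % 4 = 1 ∨ p % 4 = 3 := by
      have := hp.eq_two_or_odd
      omega
    rcases hp4 with hp4 | hp4
    · obtain ⟨a, b, hab⟩ := Nat.Prime.sq_add_sq (p := p) (by omega)
      have hπ : (⟨a, b⟩ : GaussianInt).norm = p := by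
        rw [← hab]; simp [Zsqrtd.norm]; ring
      rw [e, W_split p hp h2 _ hπ m hm k]
      exact mul_ne_zero (geom_ne p hp h2 h3 _ hπ k) hW
    · have h5 := hodd p hp hp4
      rw [hval, Nat.not_odd_iff_even] at h5
      obtain ⟨l, hl⟩ := h5
      rw [e, hl, ← two_mul, W_inert p hp hp4 m l]
      exact mul_ne_zero (pow_ne_zero _ (psi_inert_ne p hp h2 h3)) hW

/-! ### Comparison of the theta sum with `gamma3` -/

lemma sum_sym (N : ℕ) (h : ℤ → ℂ) :
    ∑ a ∈ Finset.Icc (-(N : ℤ)) N, h a = h 0 + ∑ x ∈ Finset.Icc 1 N, (h x + h (-(x : ℤ))) := by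
  induction N with
  | zero => simp
  | succ N ih =>
    have e : Finset.Icc (-((N + 1 : ℕ) : ℤ)) ((N + 1 : ℕ) : ℤ)
        = insert (-((N + 1 : ℕ) : ℤ)) (insert ((N + 1 : ℕ) : ℤ) (Finset.Icc (-(N : ℤ)) N)) := by
      ext a
      simp only [Finset.mem_insert, Finset.mem_Icc]
      omega
    rw [e, Finset.sum_insert, Finset.sum_insert, ih, Finset.sum_Icc_succ_top (by omega)]
    · ring
    · simp
    · simp; omega

/-- The sum of `psi` over the four sign changes. -/
noncomputable def FF (x y : ℕ) : ℂ :=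
  psi ⟨x, y⟩ + psi ⟨x, -y⟩ + psi ⟨-x, y⟩ + psi ⟨-x, -y⟩

/-- Positive pairs with `x ^ 2 + y ^ 2 = n`. -/
noncomputable def PP (n : ℕ) : Finset (ℕ × ℕ) :=
  (Finset.Icc 1 n ×ˢ Finset.Icc 1 n).filter (fun p => p.1 ^ 2 + p.2 ^ 2 = n)

lemma W_eq (n : ℕ) (hn : 0 < n) :
    W n = ∑ x ∈ Finset.Icc 1 n, (if x ^ 2 = n then
        psi ⟨0, x⟩ + psi ⟨0, -x⟩ + psi ⟨x, 0⟩ + psi ⟨-x, 0⟩ else 0)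
      + ∑ p ∈ PP n, FF p.1 p.2 := by
  unfold W Rg Rp PP
  rw [Finset.sum_map, Finset.sum_filter, Finset.sum_filter, Finset.sum_product, Finset.sum_product]
  simp only [gE_apply]
  rw [sum_sym]
  simp only [sum_sym]
  have split : ∀ (u v f g : ℕ → ℂ), ∑ x ∈ Finset.Icc 1 n, (u x + f x + (v x + g x)) =
      ∑ x ∈ Finset.Icc 1 n, (u x + v x) + ∑ x ∈ Finset.Icc 1 n, (f x + g x) := by
    intro u v f g
    rw [← Finset.sum_add_distrib]
    exact Finset.sum_congr rfl fun x _ => add_add_add_comm _ _ _ _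
  rw [if_neg (by simp; omega), zero_add, split, ← add_assoc, ← Finset.sum_add_distrib]
  congr 1
  · apply Finset.sum_congr rfl
    intro x _
    simp only [neg_sq]
    have : ((0 : ℤ) ^ 2 + (x : ℤ) ^ 2 = n) ↔ x ^ 2 = n := by
      rw [zero_pow two_ne_zero, zero_add]; exact_mod_cast Iff.rfl
    have h' : ((x : ℤ) ^ 2 + 0 ^ 2 = n) ↔ x ^ 2 = n := by
      rw [zero_pow two_ne_zero, add_zero]; exact_mod_cast Iff.rfl
    simp only [this, h']
    split_ifs
    · ring
    · simp
  · apply Finset.sum_congr rfl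
    intro x _
    rw [← Finset.sum_add_distrib]
    apply Finset.sum_congr rfl
    intro y _
    simp only [neg_sq]
    have : ((x : ℤ) ^ 2 + (y : ℤ) ^ 2 = n) ↔ x ^ 2 + y ^ 2 = n := by
      exact_mod_cast Iff.rfl
    simp only [this]
    unfold FF
    split_ifs
    · ring
    · simp

lemma psi_mk (a b : ℤ) : psi ⟨a, b⟩ = G3 a b * (G2 a b : ℂ) * (a + b * Complex.I) := by
  simp [psi_apply, eps, GaussianInt.toComplex_def]

lemma G3_table : G3 0 0 = 0 ∧ G3 1 0 = 1 ∧ G3 2 0 = -1 ∧ G3 0 1 = Complex.I ∧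
    G3 0 2 = -Complex.I ∧ G3 1 1 = zt ∧ G3 2 2 = -zt ∧ G3 1 2 = -Complex.I * zt ∧
    G3 2 1 = Complex.I * zt := by
  have z2 := zt_sq
  have z4 : zt ^ 4 = -1 := by
    rw [show zt ^ 4 = (zt ^ 2) ^ 2 by ring, z2]; simp
  have z6 : zt ^ 6 = Complex.I := by
    rw [show zt ^ 6 = zt ^ 4 * zt ^ 2 by ring, z2, z4]; simp
  have z3 : zt ^ 3 = -Complex.I * zt := by rw [pow_succ, z2]
  have z5 : zt ^ 5 = -zt := by rw [pow_succ, z4]; ring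
  have z7 : zt ^ 7 = Complex.I * zt := by rw [pow_succ, z6]
  have g : ∀ a b : ZMod 3, ¬ (a = 0 ∧ b = 0) → G3 a b = zt ^ t3 a b := fun a b h => if_neg h
  refine ⟨if_pos ⟨rfl, rfl⟩, ?_, ?_, ?_, ?_, ?_, ?_, ?_, ?_⟩
  · rw [g _ _ (by decide), show t3 1 0 = 0 by decide, pow_zero]
  · rw [g _ _ (by decide), show t3 2 0 = 4 by decide, z4]
  · rw [g _ _ (by decide), show t3 0 1 = 6 by decide, z6]
  · rw [g _ _ (by decide), show t3 0 2 = 2 by decide, z2]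
  · rw [g _ _ (by decide), show t3 1 1 = 1 by decide, pow_one]
  · rw [g _ _ (by decide), show t3 2 2 = 5 by decide, z5]
  · rw [g _ _ (by decide), show t3 1 2 = 3 by decide, z3]
  · rw [g _ _ (by decide), show t3 2 1 = 7 by decide, z7]

lemma cast3 (x r : ℕ) (h : x % 3 = r) : (x : ZMod 3) = (r : ZMod 3) := by
  rw [← h]; simp

lemma cast2 (x r : ℕ) (h : x % 2 = r) : (x : ZMod 2) = (r : ZMod 2) := by
  rw [← h]; simp

lemma G2_table : G2 0 1 = -1 ∧ G2 1 0 = 1 := by decide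

lemma neg3 : (-1 : ZMod 3) = 2 ∧ (-2 : ZMod 3) = 1 := by decide

/-- `χ₃ m * m` as a complex number. -/
noncomputable def cc (x : ℕ) : ℂ := ((χ₃ x * x : ℤ) : ℂ)

lemma cc0 (x : ℕ) (h : x % 3 = 0) : cc x = 0 := by simp [cc, χ₃, h]
lemma cc1 (x : ℕ) (h : x % 3 = 1) : cc x = x := by simp [cc, χ₃, h]
lemma cc2 (x : ℕ) (h : x % 3 = 2) : cc x = -x := by simp [cc, χ₃, h]

lemma axis_val (x : ℕ) (h2 : x % 2 = 1) :
    psi ⟨0, x⟩ + psi ⟨0, -x⟩ + psi ⟨x, 0⟩ + psi ⟨-x, 0⟩ = 4 * cc x := by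
  have d2 := cast2 x 1 h2
  obtain ⟨g00, g10, g20, g01, g02, g11, g22, g12, g21⟩ := G3_table
  obtain ⟨k01, k10⟩ := G2_table
  obtain ⟨n1, n2⟩ := neg3
  have hI := Complex.I_sq
  have h3 : x % 3 = 0 ∨ x % 3 = 1 ∨ x % 3 = 2 := by omega
  rcases h3 with h3 | h3 | h3
  · have d3 := cast3 x _ h3
    rw [cc0 x h3]
    simp [psi_mk, d2, d3, g00]
  · have d3 := cast3 x _ h3
    rw [cc1 x h3]
    simp [psi_mk, d2, d3, g10, g20, g01, g02, n1, n2, k01, k10]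
    linear_combination (-2 * (x : ℂ)) * hI
  · have d3 := cast3 x _ h3
    rw [cc2 x h3]
    simp [psi_mk, d2, d3, g10, g20, g01, g02, n1, n2, k01, k10]
    linear_combination (2 * (x : ℂ)) * hI

lemma res1 : ∀ a < 12, ∀ b < 12, (a ^ 2 + b ^ 2) % 12 = 1 →
    (a % 2 ≠ b % 2 ∧ (a % 3 = 0 ↔ b % 3 ≠ 0)) := by decide

lemma res5 : ∀ a < 12, ∀ b < 12, (a ^ 2 + b ^ 2) % 12 = 5 →
    (a % 2 ≠ b % 2 ∧ (a % 3 ≠ 0 ∧ b % 3 ≠ 0)) := by decide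

lemma red12 (x y n r : ℕ) (h : x ^ 2 + y ^ 2 = n) (hr : n % 12 = r) :
    ((x % 12) ^ 2 + (y % 12) ^ 2) % 12 = r := by
  rw [← hr, ← h, Nat.add_mod, ← Nat.pow_mod, ← Nat.pow_mod, ← Nat.add_mod]

/-- Half of the value of `FF` when `n % 12 = 1`. -/
noncomputable def A1 (x y : ℕ) : ℂ :=
  4 * (if 1 ∣ x ∧ 6 ∣ y then cc x else 0) - 4 * (if 2 ∣ x ∧ 3 ∣ y then cc x else 0)

/-- Half of the value of `FF` when `n % 12 = 5`. -/
noncomputable def A5 (x y : ℕ) : ℂ :=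
  2 * (zt * (1 - Complex.I)) * ((if 1 ∣ x ∧ 2 ∣ y then cc x else 0) - (if 2 ∣ x ∧ 1 ∣ y then cc x else 0))

lemma FF_one (x y n : ℕ) (h : x ^ 2 + y ^ 2 = n) (hr : n % 12 = 1) :
    FF x y = A1 x y + A1 y x := by
  obtain ⟨hp, ht⟩ := res1 _ (Nat.mod_lt x (by norm_num)) _ (Nat.mod_lt y (by norm_num))
    (red12 x y n 1 h hr)
  have hp' : (x % 2 = 0 ∧ y % 2 = 1) ∨ (x % 2 = 1 ∧ y % 2 = 0) := by omega
  have ht' : (x % 3 = 0 ∧ y % 3 = 1) ∨ (x % 3 = 0 ∧ y % 3 = 2) ∨ (x % 3 = 1 ∧ y % 3 = 0) ∨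
    (x % 3 = 2 ∧ y % 3 = 0) := by omega
  clear hp ht
  obtain ⟨g00, g10, g20, g01, g02, g11, g22, g12, g21⟩ := G3_table
  obtain ⟨k01, k10⟩ := G2_table
  obtain ⟨n1, n2⟩ := neg3
  have hI := Complex.I_sq
  have b6 : ∀ z : ℕ, 6 ∣ z ↔ (z % 2 = 0 ∧ z % 3 = 0) := by intro z; omega
  rcases hp' with ⟨hx, hy⟩ | ⟨hx, hy⟩ <;> rcases ht' with ⟨ux, uy⟩ | ⟨ux, uy⟩ | ⟨ux, uy⟩ | ⟨ux, uy⟩ <;>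
  · have dx := cast2 x _ hx
    have dy := cast2 y _ hy
    have ex := cast3 x _ ux
    have ey := cast3 y _ uy
    simp [FF, psi_mk, A1, b6, Nat.dvd_iff_mod_eq_zero, cc, χ₃, hx, hy, ux, uy, dx, dy, ex, ey,
      g10, g20, g01, g02, n1, n2, k01, k10]
    try ring_nf
    try simp [hI]
    try ring_nf

lemma FF_five (x y n : ℕ) (h : x ^ 2 + y ^ 2 = n) (hr : n % 12 = 5) :
    FF x y = A5 x y + A5 y x := by
  obtain ⟨hp, ht⟩ := res5 _ (Nat.mod_lt x (by norm_num)) _ (Nat.mod_lt y (by norm_num))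
    (red12 x y n 5 h hr)
  have hp' : (x % 2 = 0 ∧ y % 2 = 1) ∨ (x % 2 = 1 ∧ y % 2 = 0) := by omega
  have ht' : (x % 3 = 1 ∧ y % 3 = 1) ∨ (x % 3 = 1 ∧ y % 3 = 2) ∨ (x % 3 = 2 ∧ y % 3 = 1) ∨
    (x % 3 = 2 ∧ y % 3 = 2) := by omega
  clear hp ht
  obtain ⟨g00, g10, g20, g01, g02, g11, g22, g12, g21⟩ := G3_table
  obtain ⟨k01, k10⟩ := G2_table
  obtain ⟨n1, n2⟩ := neg3
  have hI := Complex.I_sq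
  rcases hp' with ⟨hx, hy⟩ | ⟨hx, hy⟩ <;> rcases ht' with ⟨ux, uy⟩ | ⟨ux, uy⟩ | ⟨ux, uy⟩ | ⟨ux, uy⟩ <;>
  · have dx := cast2 x _ hx
    have dy := cast2 y _ hy
    have ex := cast3 x _ ux
    have ey := cast3 y _ uy
    simp [FF, psi_mk, A5, Nat.dvd_iff_mod_eq_zero, cc, χ₃, hx, hy, ux, uy, dx, dy, ex, ey,
      g11, g22, g12, g21, n1, n2, k01, k10]
    try ring_nf
    try simp [hI]
    try ring_nf

lemma PP_swap (n : ℕ) (g : ℕ → ℕ → ℂ) :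
    ∑ p ∈ PP n, g p.2 p.1 = ∑ p ∈ PP n, g p.1 p.2 := by
  refine Finset.sum_nbij' Prod.swap Prod.swap ?_ ?_ ?_ ?_ ?_
  all_goals
    rintro ⟨x, y⟩ h
    simp only [PP, Finset.mem_filter, Finset.mem_product, Finset.mem_Icc, Prod.swap] at h ⊢
    try omega

lemma PP_scale (n c d : ℕ) (hc : 0 < c) (hd : 0 < d) (g : ℕ → ℂ) :
    ∑ p ∈ PP n, (if c ∣ p.1 ∧ d ∣ p.2 then g p.1 else 0) =
      ∑ p ∈ (Finset.Icc 1 n ×ˢ Finset.Icc 1 n).filter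
        (fun p => c ^ 2 * p.1 ^ 2 + d ^ 2 * p.2 ^ 2 = n), g (c * p.1) := by
  rw [← Finset.sum_filter]
  symm
  refine Finset.sum_nbij' (fun p => (c * p.1, d * p.2)) (fun p => (p.1 / c, p.2 / d)) ?_ ?_ ?_ ?_ ?_
  · rintro ⟨x, y⟩ h
    simp only [PP, Finset.mem_filter, Finset.mem_product, Finset.mem_Icc] at h ⊢
    obtain ⟨⟨⟨h1, h2⟩, h3, h4⟩, h5⟩ := h
    have a1 : 1 ≤ c * x := Nat.mul_pos hc h1
    have a2 : 1 ≤ d * y := Nat.mul_pos hd h3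
    have e : (c * x) ^ 2 + (d * y) ^ 2 = n := by rw [← h5]; ring
    refine ⟨⟨⟨⟨a1, ?_⟩, a2, ?_⟩, e⟩, dvd_mul_right _ _, dvd_mul_right _ _⟩
    · nlinarith
    · nlinarith
  · rintro ⟨x, y⟩ h
    simp only [PP, Finset.mem_filter, Finset.mem_product, Finset.mem_Icc] at h ⊢
    obtain ⟨⟨⟨⟨h1, h2⟩, h3, h4⟩, h5⟩, ⟨u, rfl⟩, ⟨v, rfl⟩⟩ := h
    rw [Nat.mul_div_cancel_left _ hc, Nat.mul_div_cancel_left _ hd]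
    have a1 : 1 ≤ u := Nat.pos_of_mul_pos_left h1
    have a2 : 1 ≤ v := Nat.pos_of_mul_pos_left h3
    exact ⟨⟨⟨a1, by nlinarith⟩, a2, by nlinarith⟩, by rw [← h5]; ring⟩
  · rintro ⟨x, y⟩ h
    simp [Nat.mul_div_cancel_left _ hc, Nat.mul_div_cancel_left _ hd]
  · rintro ⟨x, y⟩ h
    simp only [Finset.mem_filter] at h
    simp [Nat.mul_div_cancel' h.2.1, Nat.mul_div_cancel' h.2.2]
  · rintro ⟨x, y⟩ h
    rfl

lemma cc_two (x : ℕ) : cc (2 * x) = -2 * cc x := by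
  have h3 : x % 3 = 0 ∨ x % 3 = 1 ∨ x % 3 = 2 := by omega
  rcases h3 with h3 | h3 | h3
  · rw [cc0 x h3, cc0 (2 * x) (by omega)]; simp
  · rw [cc1 x h3, cc2 (2 * x) (by omega)]; push_cast; ring
  · rw [cc2 x h3, cc1 (2 * x) (by omega)]; push_cast; ring

lemma axis_one (n : ℕ) (hr : n % 12 = 1) :
    ∑ x ∈ Finset.Icc 1 n, (if x ^ 2 = n then
        psi ⟨0, x⟩ + psi ⟨0, -x⟩ + psi ⟨x, 0⟩ + psi ⟨-x, 0⟩ else 0)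
      = 4 * (if Nat.sqrt n * Nat.sqrt n = n then cc (Nat.sqrt n) else 0) := by
  have hodd : ∀ x : ℕ, x ^ 2 = n → x % 2 = 1 := by
    intro x hx
    by_contra h
    have : 2 ∣ n := by rw [← hx]; exact dvd_pow (by omega) two_ne_zero
    omega
  by_cases hs : Nat.sqrt n * Nat.sqrt n = n
  · rw [if_pos hs, Finset.sum_eq_single (Nat.sqrt n)]
    · rw [if_pos (by rw [sq]; exact hs)]
      exact axis_val _ (hodd _ (by rw [sq]; exact hs))
    · intro x _ hx
      rw [if_neg]
      intro h
      apply hx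
      rw [← h, Nat.sqrt_eq']
    · intro h
      exfalso
      apply h
      rw [Finset.mem_Icc]
      exact ⟨Nat.sqrt_pos.2 (by omega), Nat.sqrt_le_self n⟩
  · rw [if_neg hs, mul_zero]
    apply Finset.sum_eq_zero
    intro x _
    rw [if_neg]
    intro h
    apply hs
    rw [← h, Nat.sqrt_eq', sq]

lemma axis_five (n : ℕ) (hr : n % 12 = 5) (g : ℕ → ℂ) :
    ∑ x ∈ Finset.Icc 1 n, (if x ^ 2 = n then g x else 0) = 0 := by
  apply Finset.sum_eq_zero
  intro x _
  rw [if_neg]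
  intro h
  have h1 := red12 x 0 n 5 (by simpa using h) hr
  have := res5 _ (Nat.mod_lt x (by norm_num)) _ (Nat.mod_lt 0 (by norm_num)) h1
  simp at this

lemma W_one_mod (n : ℕ) (hr : n % 12 = 1) : W n = 4 * (gamma3 n : ℂ) := by
  rw [W_eq n (by omega), axis_one n hr]
  have e : ∑ p ∈ PP n, FF p.1 p.2 = 2 * ∑ p ∈ PP n, A1 p.1 p.2 := by
    rw [two_mul]
    nth_rewrite 1 [← PP_swap n A1]
    rw [← Finset.sum_add_distrib]
    apply Finset.sum_congr rfl
    intro p hp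
    rw [FF_one p.1 p.2 n (Finset.mem_filter.1 hp).2 hr, add_comm]
  rw [e]
  unfold A1
  rw [Finset.sum_sub_distrib, ← Finset.mul_sum, ← Finset.mul_sum,
    PP_scale n 1 6 (by norm_num) (by norm_num), PP_scale n 2 3 (by norm_num) (by norm_num)]
  simp only [cc_two, ← Finset.mul_sum]
  unfold gamma3
  rw [if_pos hr]
  norm_num
  unfold cc
  split_ifs <;> push_cast <;> ring

lemma W_five_mod (n : ℕ) (hr : n % 12 = 5) :
    W n = 4 * (zt * (1 - Complex.I)) * (gamma3 n : ℂ) := by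
  rw [W_eq n (by omega), axis_five n hr]
  have e : ∑ p ∈ PP n, FF p.1 p.2 = 2 * ∑ p ∈ PP n, A5 p.1 p.2 := by
    rw [two_mul]
    nth_rewrite 1 [← PP_swap n A5]
    rw [← Finset.sum_add_distrib]
    apply Finset.sum_congr rfl
    intro p hp
    rw [FF_five p.1 p.2 n (Finset.mem_filter.1 hp).2 hr, add_comm]
  rw [e]
  unfold A5
  rw [← Finset.mul_sum, Finset.sum_sub_distrib,
    PP_scale n 1 2 (by norm_num) (by norm_num), PP_scale n 2 1 (by norm_num) (by norm_num)]
  simp only [cc_two, ← Finset.mul_sum]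
  unfold gamma3
  rw [if_neg (by omega), if_pos hr]
  norm_num
  unfold cc
  push_cast
  ring

lemma gamma3_zero_of_not_rep (n : ℕ) (hn : 0 < n) (h : ¬ ∃ x y : ℕ, n = x ^ 2 + y ^ 2) :
    gamma3 n = 0 := by
  have k : ∀ (s : Finset (ℕ × ℕ)) (P : ℕ × ℕ → Prop) [DecidablePred P] (g : ℕ × ℕ → ℤ),
      (∀ p, ¬ P p) → ∑ p ∈ s.filter P, g p = 0 := by
    intro s P _ g hP
    rw [Finset.filter_false_of_mem (fun p _ => hP p), Finset.sum_empty]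
  unfold gamma3
  have hs : ¬ (Nat.sqrt n * Nat.sqrt n = n) := by
    intro e; exact h ⟨Nat.sqrt n, 0, by rw [← sq] at e; simp [e]⟩
  rw [k, k, k, k, if_neg hs]
  · simp
  · intro p e; exact h ⟨p.1, 2 * p.2, by rw [← e]; ring⟩
  · intro p e; exact h ⟨2 * p.1, p.2, by rw [← e]; ring⟩
  · intro p e; exact h ⟨p.1, 6 * p.2, by rw [← e]; ring⟩
  · intro p e; exact h ⟨2 * p.1, 3 * p.2, by rw [← e]; ring⟩

theorem gamma3_vanishing (n : ℕ) (hn : 0 < n) :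
    gamma3 n = 0 ↔
      1 < Nat.gcd n 6 ∨ ∃ p : ℕ, p.Prime ∧ p % 4 = 3 ∧ Odd (padicValNat p n) := by
  constructor
  · intro h0
    by_contra hcon
    push Not at hcon
    obtain ⟨hg, hodd⟩ := hcon
    have hc : Nat.Coprime n 6 := by
      have := Nat.gcd_pos_of_pos_left 6 hn
      unfold Nat.Coprime; omega
    have hodd' : ∀ p : ℕ, p.Prime → p % 4 = 3 → ¬ Odd (padicValNat p n) := by
      intro p hp h4
      simpa using hodd p hp h4
    have hW := W_ne n hn hc hodd'
    -- `n` is a sum of two squares, prime to 6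
    have hrep : ∃ α : GaussianInt, α ∈ Rg n := by
      by_contra hne
      push Not at hne
      apply hW
      unfold W
      exact Finset.sum_eq_zero fun α hα => (hne α hα).elim
    obtain ⟨α, hα⟩ := hrep
    rw [mem_Rg] at hα
    have hxy : α.re.natAbs ^ 2 + α.im.natAbs ^ 2 = n := by
      zify
      rw [sq_abs, sq_abs, ← hα]
      simp [Zsqrtd.norm]; ring
    have hmod : n % 12 = 1 ∨ n % 12 = 5 := by
      have h1 := red12 _ _ n _ hxy rfl
      have hc' : Nat.Coprime (n % 12) 6 := by
        have : Nat.gcd (n % 12) 6 ∣ Nat.gcd n 6 := by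
          apply Nat.dvd_gcd _ (Nat.gcd_dvd_right _ _)
          have h3 : Nat.gcd (n % 12) 6 ∣ 12 := (Nat.gcd_dvd_right _ _).trans (by norm_num)
          exact (Nat.dvd_mod_iff h3).1 (Nat.gcd_dvd_left _ _)
        rw [hc] at this
        exact Nat.dvd_one.1 this
      have key : ∀ a < 12, ∀ b < 12, Nat.gcd ((a ^ 2 + b ^ 2) % 12) 6 = 1 →
          ((a ^ 2 + b ^ 2) % 12 = 1 ∨ (a ^ 2 + b ^ 2) % 12 = 5) := by decide
      rw [← h1] at hc' ⊢
      exact key _ (Nat.mod_lt _ (by norm_num)) _ (Nat.mod_lt _ (by norm_num)) hc'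
    rcases hmod with hr | hr
    · apply hW; rw [W_one_mod n hr, h0]; simp
    · apply hW; rw [W_five_mod n hr, h0]; simp
  · rintro (hg | ⟨p, hp, h4, hodd⟩)
    · unfold gamma3
      rw [if_neg, if_neg]
      · intro h
        have : Nat.gcd n 6 = 1 := by
          rw [Nat.gcd_comm, Nat.gcd_rec, show n % 6 = 5 by omega]; rfl
        omega
      · intro h
        have : Nat.gcd n 6 = 1 := by
          rw [Nat.gcd_comm, Nat.gcd_rec, show n % 6 = 1 by omega]; rfl
        omega
    · apply gamma3_zero_of_not_rep n hn
      rw [Nat.eq_sq_add_sq_iff]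
      intro hall
      have hpn : p ∣ n := by
        by_contra hd
        rw [padicValNat.eq_zero_of_not_dvd hd] at hodd
        exact absurd hodd (by decide)
      have := hall (q := p) (by simp [hp, hpn, hn.ne']) h4
      exact (Nat.not_even_iff_odd.2 hodd) this
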